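/- arXiv:2404.05609 — 3 statements merged into one kernel-verified Lean document; each statement's English description precedes it below -/
import Mathlib

section
/- Let n ≥ 3 and γ > 0. Then the union of the Davis–Wielandt shells DW(B), taken over all n×n complex matrices B such that H(B) is positive semidefinite and γ²·I − B*B is positive semidefinite (the half-disk matrices S_γ(π/2)), is exactly the set {(x, y, z) ∈ ℝ³ : x ≥ 0 and x² + y² ≤ z ≤ γ²} = H_γ ∩ V_{π/2}. -/
open Matrix
open scoped ComplexOrder

noncomputable section

/-- Hermitian part of a complex matrix: `H(A) = (A + A*) / 2`. -/
def Hpart {n : ℕ} (A : Matrix (Fin n) (Fin n) ℂ) : Matrix (Fin n) (Fin n) ℂ :=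
  (2⁻¹ : ℂ) • (A + Aᴴ)

/-- The Davis–Wielandt shell of a complex matrix, as a subset of `ℝ × ℝ × ℝ`. -/
def DW {n : ℕ} (A : Matrix (Fin n) (Fin n) ℂ) : Set (ℝ × ℝ × ℝ) :=
  {p | ∃ u : Fin n → ℂ, star u ⬝ᵥ u = 1 ∧
    p = ((star u ⬝ᵥ A.mulVec u).re, (star u ⬝ᵥ A.mulVec u).im,
         (star (A.mulVec u) ⬝ᵥ A.mulVec u).re)}

/-- Cauchy–Schwarz inequality for a unit vector `u`. -/
lemma sq_re_add_sq_im_le_of_unit {n : ℕ} (u v : Fin n → ℂ) (hu : star u ⬝ᵥ u = 1) :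
    (star u ⬝ᵥ v).re ^ 2 + (star u ⬝ᵥ v).im ^ 2 ≤ (star v ⬝ᵥ v).re := by
  have hvu : star v ⬝ᵥ u = star (star u ⬝ᵥ v) := star_dotProduct v u
  have h := dotProduct_star_self_nonneg (v - (star u ⬝ᵥ v) • u)
  simp only [star_sub, star_smul, sub_dotProduct, dotProduct_sub, smul_dotProduct,
    dotProduct_smul, hu, hvu, smul_eq_mul] at h
  have hre := (Complex.le_def.mp h).1
  simp at hre
  nlinarith

/-- The quadratic form of the Hermitian part is the real part of the quadratic form. -/
lemma dotProduct_Hpart_mulVec {n : ℕ} (B : Matrix (Fin n) (Fin n) ℂ) (u : Fin n → ℂ) :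
    star u ⬝ᵥ (Hpart B).mulVec u = ((star u ⬝ᵥ B.mulVec u).re : ℂ) := by
  have h : star u ⬝ᵥ Bᴴ.mulVec u = star (star u ⬝ᵥ B.mulVec u) := by
    rw [dotProduct_mulVec, ← star_mulVec, star_dotProduct]
  rw [Hpart, smul_mulVec, add_mulVec, dotProduct_smul, dotProduct_add, h]
  apply Complex.ext <;> simp
  ring

/-- The quadratic form of `c • 1 - Bᴴ * B` at a unit vector. -/
lemma dotProduct_smul_one_sub_mulVec {n : ℕ} (B : Matrix (Fin n) (Fin n) ℂ) (c : ℂ)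
    (u : Fin n → ℂ) (hu : star u ⬝ᵥ u = 1) :
    star u ⬝ᵥ (c • (1 : Matrix (Fin n) (Fin n) ℂ) - Bᴴ * B).mulVec u
      = c - star (B.mulVec u) ⬝ᵥ B.mulVec u := by
  rw [sub_mulVec, dotProduct_sub, smul_mulVec, one_mulVec, dotProduct_smul, hu, star_mulVec,
    ← mulVec_mulVec, dotProduct_mulVec _ Bᴴ]
  simp

/-- The `2 × 2` matrix with rows `(w, -s)` and `(s, star w)`, padded with zeros. -/
def paddedSimilarity (m : ℕ) (w : ℂ) (s : ℝ) : Matrix (Fin (m + 2)) (Fin (m + 2)) ℂ :=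
  of (vecCons (vecCons w (vecCons (-(s : ℂ)) 0))
    (vecCons (vecCons (s : ℂ) (vecCons (star w) 0)) 0))

lemma Hpart_paddedSimilarity (m : ℕ) (w : ℂ) (s : ℝ) :
    Hpart (paddedSimilarity m w s)
      = diagonal (vecCons (w.re : ℂ) (vecCons (w.re : ℂ) 0)) := by
  have hw : (2⁻¹ : ℂ) * (w + star w) = w.re := by
    apply Complex.ext <;> simp
    ring
  have hw' : (2⁻¹ : ℂ) * (star w + w) = w.re := by rw [add_comm, hw]
  ext i j
  refine Fin.cases ?_ (fun i => Fin.cases ?_ (fun i => ?_) i) i <;>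
    refine Fin.cases ?_ (fun j => Fin.cases ?_ (fun j => ?_) j) j <;>
    simp_all [Hpart, paddedSimilarity, diagonal_apply, Fin.ext_iff]

lemma conjTranspose_mul_paddedSimilarity (m : ℕ) (w : ℂ) (s : ℝ) :
    (paddedSimilarity m w s)ᴴ * paddedSimilarity m w s
      = diagonal (vecCons (((Complex.normSq w + s ^ 2 : ℝ)) : ℂ)
        (vecCons ((Complex.normSq w + s ^ 2 : ℝ) : ℂ) 0)) := by
  have hw : star w * w = Complex.normSq w := by
    rw [mul_comm]; exact Complex.mul_conj w
  ext i j
  refine Fin.cases ?_ (fun i => Fin.cases ?_ (fun i => ?_) i) i <;>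
    refine Fin.cases ?_ (fun j => Fin.cases ?_ (fun j => ?_) j) j <;>
    simp [mul_apply, Fin.sum_univ_succ, paddedSimilarity, diagonal_apply, Fin.ext_iff] <;>
    first | ring1 | (simp only [Complex.star_def] at hw; linear_combination hw)

/-- For `n ≥ 3`, the union of the DW shells of the half-disk matrices `S_γ(π/2)` is
exactly `{(x,y,z) : x ≥ 0, x² + y² ≤ z ≤ γ²} = H_γ ∩ V_{π/2}`. -/
theorem dw_union_half_disk {n : ℕ} (hn : 3 ≤ n) (γ : ℝ) (hγ : 0 < γ) :
    (⋃ B ∈ {B : Matrix (Fin n) (Fin n) ℂ | (Hpart B).PosSemidef ∧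
        (((γ ^ 2 : ℝ) : ℂ) • (1 : Matrix (Fin n) (Fin n) ℂ) - Bᴴ * B).PosSemidef},
      DW B)
      = {p : ℝ × ℝ × ℝ | 0 ≤ p.1 ∧ p.1 ^ 2 + p.2.1 ^ 2 ≤ p.2.2 ∧ p.2.2 ≤ γ ^ 2} := by
  ext p
  simp only [Set.mem_iUnion, Set.mem_ofPred_eq, exists_prop]
  constructor
  · rintro ⟨B, ⟨hH, hN⟩, u, hu, rfl⟩
    refine ⟨?_, sq_re_add_sq_im_le_of_unit u _ hu, ?_⟩
    · have h := hH.dotProduct_mulVec_nonneg u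
      rw [dotProduct_Hpart_mulVec] at h
      exact_mod_cast h
    · have h := hN.dotProduct_mulVec_nonneg u
      rw [dotProduct_smul_one_sub_mulVec B _ u hu] at h
      have hre := (Complex.le_def.mp h).1
      rw [Complex.sub_re, Complex.ofReal_re, Complex.zero_re] at hre
      exact sub_nonneg.mp hre
  · obtain ⟨x, y, z⟩ := p
    rintro ⟨hx, hxyz, hz⟩
    dsimp only at hx hxyz hz
    obtain ⟨m, rfl⟩ : ∃ m, n = m + 2 := ⟨n - 2, by lia⟩
    have hs : Complex.normSq ⟨x, y⟩ + √(z - (x ^ 2 + y ^ 2)) ^ 2 = z := by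
      rw [Real.sq_sqrt (by linarith), Complex.normSq_mk]
      ring
    have hBB := conjTranspose_mul_paddedSimilarity m ⟨x, y⟩ √(z - (x ^ 2 + y ^ 2))
    rw [hs] at hBB
    refine ⟨paddedSimilarity m ⟨x, y⟩ √(z - (x ^ 2 + y ^ 2)), ⟨?_, ?_⟩, Pi.single 0 1, ?_, ?_⟩
    · rw [Hpart_paddedSimilarity]
      refine PosSemidef.diagonal fun i => ?_
      refine Fin.cases ?_ (fun i => Fin.cases ?_ (fun i => ?_) i) i <;> simp [hx]
    · rw [hBB, smul_one_eq_diagonal, diagonal_sub]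
      refine PosSemidef.diagonal fun i => ?_
      refine Fin.cases ?_ (fun i => Fin.cases ?_ (fun i => ?_) i) i
      · simpa using mod_cast hz
      · simpa using mod_cast hz
      · simpa using mod_cast sq_nonneg γ
    · simp
    · rw [star_mulVec, ← dotProduct_mulVec, mulVec_mulVec, hBB]
      simp [paddedSimilarity]
end
end

section
/- Let n ≥ 3, let δ ≥ γ > 0 and α ∈ [0, π/2), and let A be an invertible n×n complex matrix. Then DW(−A⁻¹) ∩ (H_γ ∩ V_α ∩ K_δ) = ∅ if and only if there exist nonnegative real numbers k₁, k₂, k₃, k₄ such that the Hermitian matrix k₁·(I − γ²·A*A) + k₂·H(e^{−i(π/2−α)}·A) + k₃·H(e^{i(π/2−α)}·A) + k₄·(δ·H(A) + I) is positive definite. -/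
open Matrix
open scoped ComplexOrder

noncomputable section

/-- `H_γ = {(x,y,z) ∈ P : z ≤ γ²}`. -/
def Hset (γ : ℝ) : Set (ℝ × ℝ × ℝ) :=
  {p | p.1 ^ 2 + p.2.1 ^ 2 ≤ p.2.2 ∧ p.2.2 ≤ γ ^ 2}

/-- `V_α = {(x,y,z) ∈ P : x ≥ 0 and |y|·cos α ≤ x·sin α}`. -/
def Vset (α : ℝ) : Set (ℝ × ℝ × ℝ) :=
  {p | p.1 ^ 2 + p.2.1 ^ 2 ≤ p.2.2 ∧ 0 ≤ p.1 ∧ |p.2.1| * Real.cos α ≤ p.1 * Real.sin α}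

/-- `K_k = {(x,y,z) ∈ P : z ≤ k·x}`. -/
def Kset (k : ℝ) : Set (ℝ × ℝ × ℝ) :=
  {p | p.1 ^ 2 + p.2.1 ^ 2 ≤ p.2.2 ∧ p.2.2 ≤ k * p.1}

/-- A positive semidefinite singular `2 × 2` array has rank at most one. -/
lemma exists_factor_of_mul_eq_normSq (s t : ℝ) (c : ℂ) (hs : 0 ≤ s) (ht : 0 ≤ t)
    (h : s * t = Complex.normSq c) :
    ∃ p q : ℂ, star p * p = s ∧ star q * q = t ∧ star p * q = c := by
  rcases hs.eq_or_lt with rfl | hs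
  · have hc : c = 0 := by simpa using h.symm
    refine ⟨0, (√t : ℝ), by simp, ?_, by simp [hc]⟩
    simp only [Complex.star_def, Complex.conj_ofReal]
    rw [← Complex.ofReal_mul, Real.mul_self_sqrt ht]
  · have h0 : ((√s : ℝ) : ℂ) ≠ 0 := by exact_mod_cast (Real.sqrt_pos.2 hs).ne'
    have h1 : ((√s : ℝ) : ℂ) * ((√s : ℝ) : ℂ) = s := by
      rw [← Complex.ofReal_mul, Real.mul_self_sqrt hs.le]
    refine ⟨(√s : ℝ), c / (√s : ℝ), ?_, ?_, ?_⟩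
    · simp only [Complex.star_def, Complex.conj_ofReal, h1]
    · simp only [Complex.star_def, Complex.conj_ofReal, map_div₀]
      rw [div_mul_div_comm, h1, ← Complex.normSq_eq_conj_mul_self, ← h]
      have : (s : ℂ) ≠ 0 := by exact_mod_cast hs.ne'
      push_cast
      field_simp
    · simp only [Complex.star_def, Complex.conj_ofReal]
      field_simp

/-- A Hermitian perturbation of the identity which is not positive semidefinite reaches the
boundary of the positive semidefinite cone. -/
lemma exists_boundary_of_not_posSemidef (d e : ℝ) (c : ℂ)
    (h : ¬ (0 ≤ d ∧ 0 ≤ e ∧ Complex.normSq c ≤ d * e)) :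
    ∃ τ : ℝ, 0 ≤ τ ∧ 0 ≤ 1 + τ * d ∧ 0 ≤ 1 + τ * e ∧
      (1 + τ * d) * (1 + τ * e) = Complex.normSq (τ * c) := by
  set N := Complex.normSq c with hN
  have hN0 : 0 ≤ N := Complex.normSq_nonneg c
  obtain ⟨r, hr0, hr⟩ : ∃ r : ℝ, 0 ≤ r ∧ r ^ 2 = (d - e) ^ 2 + 4 * N :=
    ⟨√((d - e) ^ 2 + 4 * N), Real.sqrt_nonneg _, Real.sq_sqrt (by positivity)⟩
  have hrd : |d - e| ≤ r := abs_le_of_sq_le_sq (by linarith) hr0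
  obtain ⟨h1, h2⟩ := abs_le.1 hrd
  obtain ⟨l, hl⟩ : ∃ l : ℝ, l = (r - d - e) / 2 := ⟨_, rfl⟩
  have hlpos : 0 < l := by
    by_contra hneg
    push Not at hneg
    refine h ⟨by linarith, by linarith, ?_⟩
    nlinarith
  have hroot : (l + d) * (l + e) = N := by rw [hl]; linarith
  refine ⟨l⁻¹, by positivity, ?_, ?_, ?_⟩
  · have : 1 + l⁻¹ * d = l⁻¹ * (l + d) := by field_simp
    rw [this]; exact mul_nonneg (by positivity) (by linarith)
  · have : 1 + l⁻¹ * e = l⁻¹ * (l + e) := by field_simp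
    rw [this]; exact mul_nonneg (by positivity) (by linarith)
  · rw [Complex.normSq_mul, Complex.normSq_ofReal, ← hN, ← hroot]
    field_simp

lemma eq_zero_of_posSemidef_of_trace_mul_gram_eq_zero (d e g₁ g₂ : ℝ) (c g : ℂ)
    (hd : 0 ≤ d) (he : 0 ≤ e) (hc : Complex.normSq c ≤ d * e)
    (hg₁ : 0 ≤ g₁) (hg₂ : 0 ≤ g₂) (hg : Complex.normSq g < g₁ * g₂)
    (h : d * g₁ + e * g₂ + 2 * (c * g).re = 0) : d = 0 ∧ e = 0 ∧ c = 0 := by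
  have hgn := Complex.normSq_nonneg g
  have hcn := Complex.normSq_nonneg c
  have hp1 : 0 < g₁ := hg₁.lt_of_ne (by rintro rfl; linarith)
  have hp2 : 0 < g₂ := hg₂.lt_of_ne (by rintro rfl; linarith)
  have hre : (c * g).re ^ 2 ≤ Complex.normSq c * Complex.normSq g := by
    rw [← Complex.normSq_mul, Complex.normSq_apply]; nlinarith [sq_nonneg (c * g).im]
  have h1 : Complex.normSq c * Complex.normSq g ≤ d * e * Complex.normSq g :=
    mul_le_mul_of_nonneg_right hc hgn
  have h2 : (d * g₁ + e * g₂) ^ 2 = 4 * (c * g).re ^ 2 := by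
    have : d * g₁ + e * g₂ = - (2 * (c * g).re) := by linarith
    rw [this]; ring
  have hde : d * e = 0 := by
    by_contra hne
    have : 0 < d * e := (mul_nonneg hd he).lt_of_ne (Ne.symm hne)
    nlinarith [sq_nonneg (d * g₁ - e * g₂), mul_pos this (sub_pos.2 hg)]
  have hc0 : c = 0 := Complex.normSq_eq_zero.1 (by linarith)
  subst hc0
  have : d * g₁ + e * g₂ = 0 := by simpa using h
  have hd' := mul_nonneg hd hp1.le
  have he' := mul_nonneg he hp2.le
  refine ⟨?_, ?_, rfl⟩
  · exact (mul_eq_zero.1 (by linarith : d * g₁ = 0)).resolve_right hp1.ne'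
  · exact (mul_eq_zero.1 (by linarith : e * g₂ = 0)).resolve_right hp2.ne'

lemma star_dotProduct_mulVec_smul_add_smul {n : ℕ} (M : Matrix (Fin n) (Fin n) ℂ)
    (v w : Fin n → ℂ) (p q : ℂ) :
    star (p • v + q • w) ⬝ᵥ M *ᵥ (p • v + q • w) =
      star p * p * (star v ⬝ᵥ M *ᵥ v) + star q * q * (star w ⬝ᵥ M *ᵥ w)
        + star p * q * (star v ⬝ᵥ M *ᵥ w) + star (star p * q) * (star w ⬝ᵥ M *ᵥ v) := by
  simp only [star_add, star_smul, mulVec_add, mulVec_smul, add_dotProduct, dotProduct_add,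
    smul_dotProduct, dotProduct_smul, smul_eq_mul, star_mul', star_star]
  ring

lemma exists_form_eq_add_of_dependent {n : ℕ} (v w : Fin n → ℂ)
    (h : (star v ⬝ᵥ v).re * (star w ⬝ᵥ w).re ≤ Complex.normSq (star v ⬝ᵥ w)) :
    ∃ x : Fin n → ℂ, ∀ M : Matrix (Fin n) (Fin n) ℂ,
      star x ⬝ᵥ M *ᵥ x = star v ⬝ᵥ M *ᵥ v + star w ⬝ᵥ M *ᵥ w := by
  by_cases hw : w = 0
  · exact ⟨v, fun M => by simp [hw]⟩
  have hv' : ((star v ⬝ᵥ v).re : ℂ) = star v ⬝ᵥ v :=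
    Complex.conj_eq_iff_re.1 (by rw [← Complex.star_def, ← star_dotProduct_star]; simp)
  have hw' : ((star w ⬝ᵥ w).re : ℂ) = star w ⬝ᵥ w :=
    Complex.conj_eq_iff_re.1 (by rw [← Complex.star_def, ← star_dotProduct_star]; simp)
  set g₁ := (star v ⬝ᵥ v).re
  set g₂ := (star w ⬝ᵥ w).re
  set g := star v ⬝ᵥ w with hgdef
  have hg : star w ⬝ᵥ v = star g := by rw [hgdef, ← star_dotProduct_star, star_star]
  have hne : (g₂ : ℂ) ≠ 0 := by rw [hw']; simpa using hw
  have hg₂ : 0 ≤ g₂ := by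
    have := dotProduct_star_self_nonneg w
    exact (Complex.le_def.1 this).1
  have hx : (g₂ : ℂ) • v + (-star g) • w = 0 := by
    have key := star_dotProduct_mulVec_smul_add_smul (1 : Matrix (Fin n) (Fin n) ℂ) v w g₂ (-star g)
    simp only [one_mulVec, ← hv', ← hw', hg, ← hgdef] at key
    have hval : star ((g₂ : ℂ) • v + (-star g) • w) ⬝ᵥ ((g₂ : ℂ) • v + (-star g) • w)
        = ((g₂ * (g₁ * g₂ - Complex.normSq g) : ℝ) : ℂ) := by
      rw [key]
      push_cast
      rw [← Complex.mul_conj]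
      simp only [Complex.star_def, map_neg, map_mul, Complex.conj_ofReal, Complex.conj_conj]
      ring
    have hnn := dotProduct_star_self_nonneg ((g₂ : ℂ) • v + (-star g) • w)
    rw [hval] at hnn
    have hnn' : 0 ≤ g₂ * (g₁ * g₂ - Complex.normSq g) := by exact_mod_cast hnn
    have hnp : g₂ * (g₁ * g₂ - Complex.normSq g) ≤ 0 :=
      mul_nonpos_of_nonneg_of_nonpos hg₂ (by linarith)
    rw [← dotProduct_star_self_eq_zero, hval, le_antisymm hnp hnn', Complex.ofReal_zero]
  obtain ⟨k, hk⟩ : ∃ k : ℂ, v = k • w := by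
    refine ⟨(g₂ : ℂ)⁻¹ * star g, ?_⟩
    rw [mul_smul, eq_inv_smul_iff₀ hne]
    rwa [neg_smul, ← sub_eq_add_neg, sub_eq_zero] at hx
  refine ⟨((√(1 + Complex.normSq k) : ℝ) : ℂ) • w, fun M => ?_⟩
  have hs : ((√(1 + Complex.normSq k) : ℝ) : ℂ) * (√(1 + Complex.normSq k) : ℝ)
      = 1 + star k * k := by
    rw [← Complex.ofReal_mul, Real.mul_self_sqrt (by linarith [Complex.normSq_nonneg k])]
    push_cast
    rw [Complex.normSq_eq_conj_mul_self]; rfl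
  rw [hk]
  simp only [star_smul, mulVec_smul, smul_dotProduct, dotProduct_smul, smul_eq_mul,
    Complex.star_def, Complex.conj_ofReal] at hs ⊢
  linear_combination (star w ⬝ᵥ M *ᵥ w) * hs

/-- A one-sided convexity property of the joint numerical range of `1`, `B` and `C`. -/
lemma exists_form_eq_add_and_le {n : ℕ} (B C : Matrix (Fin n) (Fin n) ℂ) (v w : Fin n → ℂ) :
    ∃ x : Fin n → ℂ, star x ⬝ᵥ x = star v ⬝ᵥ v + star w ⬝ᵥ w ∧
      star x ⬝ᵥ B *ᵥ x = star v ⬝ᵥ B *ᵥ v + star w ⬝ᵥ B *ᵥ w ∧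
      (star v ⬝ᵥ C *ᵥ v).re + (star w ⬝ᵥ C *ᵥ w).re ≤ (star x ⬝ᵥ C *ᵥ x).re := by
  rcases le_or_gt ((star v ⬝ᵥ v).re * (star w ⬝ᵥ w).re) (Complex.normSq (star v ⬝ᵥ w))
    with hdep | hind
  · obtain ⟨x, hx⟩ := exists_form_eq_add_of_dependent v w hdep
    refine ⟨x, by simpa using hx 1, hx B, by rw [hx C, Complex.add_re]⟩
  let L (M : Matrix (Fin n) (Fin n) ℂ) : ℝ × ℝ × ℂ →ₗ[ℝ] ℂ :=
    { toFun := fun D => D.1 * (star v ⬝ᵥ M *ᵥ v) + D.2.1 * (star w ⬝ᵥ M *ᵥ w)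
        + D.2.2 * (star v ⬝ᵥ M *ᵥ w) + star D.2.2 * (star w ⬝ᵥ M *ᵥ v)
      map_add' := fun D E => by simp; ring
      map_smul' := fun r D => by simp; ring }
  have hL (M D) : L M D = D.1 * (star v ⬝ᵥ M *ᵥ v) + D.2.1 * (star w ⬝ᵥ M *ᵥ w)
        + D.2.2 * (star v ⬝ᵥ M *ᵥ w) + star D.2.2 * (star w ⬝ᵥ M *ᵥ v) := rfl
  obtain ⟨D, hDker, hD0⟩ := Submodule.exists_mem_ne_zero_of_ne_bot
    (LinearMap.ker_ne_bot_of_finrank_lt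
      (f := (Complex.reLm ∘ₗ L 1).prod (L B)) (by simp))
  have h1 : (L 1 D).re = 0 := congrArg Prod.fst hDker
  have hB : L B D = 0 := congrArg Prod.snd hDker
  obtain ⟨D, hD0, h1, hB, hC⟩ : ∃ D, D ≠ 0 ∧ (L 1 D).re = 0 ∧ L B D = 0 ∧ 0 ≤ (L C D).re := by
    rcases le_total 0 (L C D).re with h | h
    · exact ⟨D, hD0, h1, hB, h⟩
    · exact ⟨-D, neg_ne_zero.2 hD0, by simp [h1], by simp [hB], by simpa using h⟩
  have hgram : star w ⬝ᵥ v = star (star v ⬝ᵥ w) := by rw [← star_dotProduct_star, star_star]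
  have hnpsd : ¬ (0 ≤ D.1 ∧ 0 ≤ D.2.1 ∧ Complex.normSq D.2.2 ≤ D.1 * D.2.1) := by
    rintro ⟨hd, he, hc⟩
    have hzero := eq_zero_of_posSemidef_of_trace_mul_gram_eq_zero D.1 D.2.1
      (star v ⬝ᵥ v).re (star w ⬝ᵥ w).re D.2.2 (star v ⬝ᵥ w) hd he hc
      (Complex.le_def.1 (dotProduct_star_self_nonneg v)).1
      (Complex.le_def.1 (dotProduct_star_self_nonneg w)).1 hind (by
        rw [hL, one_mulVec, one_mulVec, hgram] at h1
        simp at h1 ⊢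
        linarith)
    exact hD0 (Prod.ext hzero.1 (Prod.ext hzero.2.1 hzero.2.2))
  obtain ⟨τ, hτ, hs, ht, hst⟩ := exists_boundary_of_not_posSemidef D.1 D.2.1 D.2.2 hnpsd
  obtain ⟨p, q, hp, hq, hpq⟩ := exists_factor_of_mul_eq_normSq _ _ _ hs ht hst
  have hform (M : Matrix (Fin n) (Fin n) ℂ) :
      star (p • v + q • w) ⬝ᵥ M *ᵥ (p • v + q • w)
        = star v ⬝ᵥ M *ᵥ v + star w ⬝ᵥ M *ᵥ w + τ * L M D := by
    rw [star_dotProduct_mulVec_smul_add_smul, hp, hq, hpq, hL]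
    simp
    ring
  refine ⟨p • v + q • w, ?_, ?_, ?_⟩
  · have him : (L 1 D).im = 0 := by
      have hvv := (Complex.le_def.1 (dotProduct_star_self_nonneg v)).2
      have hww := (Complex.le_def.1 (dotProduct_star_self_nonneg w)).2
      rw [hL, one_mulVec, one_mulVec, hgram]
      simp at hvv hww ⊢
      rw [← hvv, ← hww]
      ring
    have h0 : L 1 D = 0 := Complex.ext h1 him
    simpa [h0] using hform 1
  · simpa [hB] using hform B
  · rw [hform C]
    simp only [Complex.add_re, Complex.re_ofReal_mul]
    nlinarith [mul_nonneg hτ hC]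

lemma isCompact_setOf_star_dotProduct_self_eq_one (n : ℕ) :
    IsCompact {v : Fin n → ℂ | star v ⬝ᵥ v = 1} := by
  refine Metric.isCompact_of_isClosed_isBounded ?_ ?_
  · exact isClosed_eq (by fun_prop) continuous_const
  · refine (Metric.isBounded_closedBall (x := 0) (r := 1)).subset fun v hv => ?_
    rw [mem_closedBall_zero_iff, pi_norm_le_iff_of_nonneg zero_le_one]
    intro i
    have hsum : ∑ j, Complex.normSq (v j) = 1 := by
      have hv' : star v ⬝ᵥ v = 1 := hv
      simp only [dotProduct, Pi.star_apply, Complex.star_def,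
        ← Complex.normSq_eq_conj_mul_self] at hv'
      exact_mod_cast hv'
    have hi := Finset.single_le_sum (f := fun j => Complex.normSq (v j))
      (fun j _ => Complex.normSq_nonneg _) (Finset.mem_univ i)
    rw [hsum, Complex.normSq_eq_norm_sq] at hi
    exact (sq_le_one_iff₀ (norm_nonneg _)).1 hi

lemma exists_smul_star_dotProduct_self_eq_one {n : ℕ} {v : Fin n → ℂ} (hv : v ≠ 0) :
    ∃ r : ℝ, 0 < r ∧ star ((r : ℂ) • v) ⬝ᵥ ((r : ℂ) • v) = 1 := by
  obtain ⟨hre, him⟩ := Complex.lt_def.1 (dotProduct_star_self_pos_iff.2 hv)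
  simp only [Complex.zero_re, Complex.zero_im] at hre him
  refine ⟨(√(star v ⬝ᵥ v).re)⁻¹, by positivity, ?_⟩
  have h : star v ⬝ᵥ v = ((star v ⬝ᵥ v).re : ℂ) := Complex.ext rfl (by simp [← him])
  simp only [star_smul, smul_dotProduct, dotProduct_smul, smul_eq_mul, Complex.star_def,
    Complex.conj_ofReal]
  rw [h, Complex.ofReal_re, ← mul_assoc, ← Complex.ofReal_mul, ← Complex.ofReal_mul,
    Complex.ofReal_eq_one, ← mul_inv, Real.mul_self_sqrt hre.le, inv_mul_cancel₀ hre.ne']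

open scoped Pointwise in
/-- Lossless S-procedure for a family of quadratic forms which is convex up to domination. -/
lemma exists_nonneg_multipliers {n m : ℕ} [NeZero n] (q : (Fin n → ℂ) → Fin m → ℝ)
    (hcont : Continuous q) (hsmul : ∀ (r : ℝ) v, q ((r : ℂ) • v) = r ^ 2 • q v)
    (hadd : ∀ v w, ∃ x, star x ⬝ᵥ x = star v ⬝ᵥ v + star w ⬝ᵥ w ∧ q x ≤ q v + q w)
    (hpos : ∀ v, v ≠ 0 → ∃ i, 0 < q v i) :
    ∃ k : Fin m → ℝ, 0 ≤ k ∧ ∀ v, v ≠ 0 → 0 < ∑ i, k i * q v i := by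
  set S : Set (Fin m → ℝ) := q '' {v | star v ⬝ᵥ v = 1} + Set.Ici (0 : Fin m → ℝ) with hS
  have hmem (y : Fin m → ℝ) : y ∈ S ↔ ∃ v, star v ⬝ᵥ v = 1 ∧ q v ≤ y := by
    rw [hS, Set.mem_add]
    constructor
    · rintro ⟨_, ⟨v, hv, rfl⟩, z, hz, rfl⟩
      exact ⟨v, hv, le_add_of_nonneg_right hz⟩
    · rintro ⟨v, hv, hle⟩
      exact ⟨q v, ⟨v, hv, rfl⟩, y - q v, sub_nonneg.2 hle, by simp⟩
  have hclosed : IsClosed S := isClosed_Ici.add_left_of_isCompact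
    ((isCompact_setOf_star_dotProduct_self_eq_one n).image hcont)
  have hconv : Convex ℝ S := by
    intro y hy z hz a b ha hb hab
    obtain ⟨v, hv, hvy⟩ := (hmem y).1 hy
    obtain ⟨w, hw, hwz⟩ := (hmem z).1 hz
    obtain ⟨x, hx, hqx⟩ := hadd ((√a : ℂ) • v) ((√b : ℂ) • w)
    refine (hmem _).2 ⟨x, ?_, ?_⟩
    · rw [hx]
      simp only [star_smul, smul_dotProduct, dotProduct_smul, smul_eq_mul, Complex.star_def,
        Complex.conj_ofReal, hv, hw, mul_one]
      rw [← Complex.ofReal_mul, ← Complex.ofReal_mul, Real.mul_self_sqrt ha,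
        Real.mul_self_sqrt hb, ← Complex.ofReal_add, hab, Complex.ofReal_one]
    · rw [hsmul, hsmul, Real.sq_sqrt ha, Real.sq_sqrt hb] at hqx
      exact hqx.trans (add_le_add (smul_le_smul_of_nonneg_left hvy ha)
        (smul_le_smul_of_nonneg_left hwz hb))
  have hzero : (0 : Fin m → ℝ) ∉ S := by
    intro h
    obtain ⟨v, hv, hle⟩ := (hmem 0).1 h
    obtain ⟨i, hi⟩ := hpos v (by rintro rfl; simp at hv)
    exact (hle i).not_gt hi
  obtain ⟨f, u, hu, hf⟩ := geometric_hahn_banach_point_closed hconv hclosed hzero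
  rw [map_zero] at hu
  have hfsum (y : Fin m → ℝ) : f y = ∑ i, f (Pi.single i 1) * y i := by
    conv_lhs => rw [pi_eq_sum_univ' y]
    simp [map_sum, mul_comm]
  refine ⟨fun i => f (Pi.single i 1), fun i => ?_, fun v hv => ?_⟩
  · obtain ⟨r, -, hr⟩ := exists_smul_star_dotProduct_self_eq_one
      (v := (1 : Fin n → ℂ)) one_ne_zero
    by_contra! hneg
    simp only [Pi.zero_apply] at hneg
    set x := (r : ℂ) • (1 : Fin n → ℂ)
    have hx := hf (q x) ((hmem _).2 ⟨x, hr, le_rfl⟩)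
    set t := f (q x) / -f (Pi.single i 1)
    have ht : 0 ≤ t := div_nonneg (hu.trans hx).le (by linarith)
    have hy := hf (q x + t • Pi.single i 1) ((hmem _).2 ⟨x, hr,
      le_add_of_nonneg_right (smul_nonneg ht (Pi.single_nonneg.2 zero_le_one))⟩)
    rw [map_add, map_smul, smul_eq_mul] at hy
    have : t * f (Pi.single i 1) = - f (q x) := by
      rw [div_mul_eq_mul_div, div_neg, mul_div_cancel_right₀ _ hneg.ne]
    linarith
  · obtain ⟨r, hr0, hr⟩ := exists_smul_star_dotProduct_self_eq_one hv
    have hx := hu.trans (hf (q ((r : ℂ) • v)) ((hmem _).2 ⟨_, hr, le_rfl⟩))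
    rw [hsmul, map_smul, smul_eq_mul, hfsum] at hx
    exact pos_of_mul_pos_right hx (by positivity)

/-- The real quadratic forms of the four matrices in the linear matrix inequality. -/
def lmiForms {n : ℕ} (γ δ α : ℝ) (A : Matrix (Fin n) (Fin n) ℂ) (v : Fin n → ℂ) : Fin 4 → ℝ :=
  ![(star v ⬝ᵥ v).re - γ ^ 2 * (star v ⬝ᵥ (Aᴴ * A) *ᵥ v).re,
    (star v ⬝ᵥ A *ᵥ v).re * Real.sin α + (star v ⬝ᵥ A *ᵥ v).im * Real.cos α,
    (star v ⬝ᵥ A *ᵥ v).re * Real.sin α - (star v ⬝ᵥ A *ᵥ v).im * Real.cos α,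
    δ * (star v ⬝ᵥ A *ᵥ v).re + (star v ⬝ᵥ v).re]

lemma continuous_lmiForms {n : ℕ} (γ δ α : ℝ) (A : Matrix (Fin n) (Fin n) ℂ) :
    Continuous (lmiForms γ δ α A) := by
  refine continuous_pi fun i => ?_
  fin_cases i <;> simp only [lmiForms] <;> simp <;> fun_prop

lemma lmiForms_smul {n : ℕ} (γ δ α : ℝ) (A : Matrix (Fin n) (Fin n) ℂ) (r : ℝ)
    (v : Fin n → ℂ) : lmiForms γ δ α A ((r : ℂ) • v) = r ^ 2 • lmiForms γ δ α A v := by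
  ext i
  fin_cases i <;> simp [lmiForms, mulVec_smul] <;> ring

lemma exists_lmiForms_le_add {n : ℕ} (γ δ α : ℝ) (A : Matrix (Fin n) (Fin n) ℂ)
    (v w : Fin n → ℂ) : ∃ x, star x ⬝ᵥ x = star v ⬝ᵥ v + star w ⬝ᵥ w ∧
      lmiForms γ δ α A x ≤ lmiForms γ δ α A v + lmiForms γ δ α A w := by
  obtain ⟨x, h1, hA, hC⟩ := exists_form_eq_add_and_le A (Aᴴ * A) v w
  refine ⟨x, h1, fun i => ?_⟩
  have hC' := mul_le_mul_of_nonneg_left hC (sq_nonneg γ)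
  fin_cases i <;> simp [lmiForms, h1, hA] at hC' ⊢ <;> linarith

lemma isHermitian_Hpart {n : ℕ} (B : Matrix (Fin n) (Fin n) ℂ) : (Hpart B).IsHermitian := by
  simp [Matrix.IsHermitian, Hpart, conjTranspose_smul, add_comm]

lemma star_dotProduct_Hpart_mulVec {n : ℕ} (B : Matrix (Fin n) (Fin n) ℂ) (v : Fin n → ℂ) :
    star v ⬝ᵥ Hpart B *ᵥ v = ((star v ⬝ᵥ B *ᵥ v).re : ℂ) := by
  have h : star v ⬝ᵥ Bᴴ *ᵥ v = star (star v ⬝ᵥ B *ᵥ v) := by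
    rw [← star_dotProduct_star, star_star, star_mulVec, dotProduct_comm,
      dotProduct_comm, dotProduct_mulVec]
  rw [Hpart, smul_mulVec, dotProduct_smul, add_mulVec, dotProduct_add, h, Complex.star_def,
    Complex.add_conj, smul_eq_mul]
  push_cast
  ring

lemma isHermitian_lmi {n : ℕ} (γ δ α : ℝ) (A : Matrix (Fin n) (Fin n) ℂ) (k₁ k₂ k₃ k₄ : ℝ) :
    (k₁ • ((1 : Matrix (Fin n) (Fin n) ℂ) - ((γ ^ 2 : ℝ) : ℂ) • (Aᴴ * A))
      + k₂ • Hpart (Complex.exp (-Complex.I * ((Real.pi / 2 - α : ℝ) : ℂ)) • A)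
      + k₃ • Hpart (Complex.exp (Complex.I * ((Real.pi / 2 - α : ℝ) : ℂ)) • A)
      + k₄ • (((δ : ℂ) • Hpart A) + 1)).IsHermitian := by
  have hreal (r : ℝ) {B : Matrix (Fin n) (Fin n) ℂ} (hB : B.IsHermitian) :
      (r • B).IsHermitian := hB.smul (IsSelfAdjoint.all r)
  have hcomplex (r : ℝ) {B : Matrix (Fin n) (Fin n) ℂ} (hB : B.IsHermitian) :
      ((r : ℂ) • B).IsHermitian := hB.smul (Complex.conj_ofReal r)
  exact (((hreal _ (isHermitian_one.sub (hcomplex _ (isHermitian_conjTranspose_mul_self A)))).add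
    (hreal _ (isHermitian_Hpart _))).add (hreal _ (isHermitian_Hpart _))).add
    (hreal _ ((hcomplex _ (isHermitian_Hpart _)).add isHermitian_one))

lemma star_dotProduct_lmi_mulVec {n : ℕ} (γ δ α : ℝ) (A : Matrix (Fin n) (Fin n) ℂ)
    (k₁ k₂ k₃ k₄ : ℝ) (v : Fin n → ℂ) :
    star v ⬝ᵥ (k₁ • ((1 : Matrix (Fin n) (Fin n) ℂ) - ((γ ^ 2 : ℝ) : ℂ) • (Aᴴ * A))
      + k₂ • Hpart (Complex.exp (-Complex.I * ((Real.pi / 2 - α : ℝ) : ℂ)) • A)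
      + k₃ • Hpart (Complex.exp (Complex.I * ((Real.pi / 2 - α : ℝ) : ℂ)) • A)
      + k₄ • (((δ : ℂ) • Hpart A) + 1)) *ᵥ v
      = ((k₁ * lmiForms γ δ α A v 0 + k₂ * lmiForms γ δ α A v 1 + k₃ * lmiForms γ δ α A v 2
          + k₄ * lmiForms γ δ α A v 3 : ℝ) : ℂ) := by
  have hexp : Complex.exp (Complex.I * ((Real.pi / 2 - α : ℝ) : ℂ))
      = Real.sin α + Real.cos α * Complex.I := by
    rw [mul_comm, Complex.exp_mul_I, ← Complex.ofReal_cos, ← Complex.ofReal_sin,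
      Real.cos_pi_div_two_sub, Real.sin_pi_div_two_sub]
  have hexp' : Complex.exp (-Complex.I * ((Real.pi / 2 - α : ℝ) : ℂ))
      = Real.sin α - Real.cos α * Complex.I := by
    rw [neg_mul, mul_comm, ← neg_mul, ← Complex.ofReal_neg, Complex.exp_mul_I,
      ← Complex.ofReal_cos, ← Complex.ofReal_sin, Real.cos_neg, Real.sin_neg,
      Real.cos_pi_div_two_sub, Real.sin_pi_div_two_sub]
    push_cast
    ring
  have hvv : star v ⬝ᵥ v = ((star v ⬝ᵥ v).re : ℂ) :=
    Complex.ext rfl (Complex.le_def.1 (dotProduct_star_self_nonneg v)).2.symm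
  have hAA : star v ⬝ᵥ (Aᴴ * A) *ᵥ v = ((star v ⬝ᵥ (Aᴴ * A) *ᵥ v).re : ℂ) :=
    Complex.ext rfl (Complex.le_def.1
      ((posSemidef_conjTranspose_mul_self A).dotProduct_mulVec_nonneg v)).2.symm
  simp only [add_mulVec, sub_mulVec, smul_mulVec, dotProduct_add, dotProduct_sub, dotProduct_smul,
    one_mulVec, star_dotProduct_Hpart_mulVec, hexp, hexp', Complex.real_smul, smul_eq_mul]
  rw [hAA, hvv]
  simp [lmiForms]
  ring

lemma mem_inter_iff_lmiForms_nonpos {n : ℕ} {γ δ α : ℝ} (hδ : 0 < δ) (hα : 0 ≤ Real.cos α)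
    (A : Matrix (Fin n) (Fin n) ℂ) (hA : IsUnit A.det) {v : Fin n → ℂ}
    (hv : star (A *ᵥ v) ⬝ᵥ A *ᵥ v = 1) :
    ((star (A *ᵥ v) ⬝ᵥ (-A⁻¹) *ᵥ (A *ᵥ v)).re, (star (A *ᵥ v) ⬝ᵥ (-A⁻¹) *ᵥ (A *ᵥ v)).im,
      (star ((-A⁻¹) *ᵥ (A *ᵥ v)) ⬝ᵥ (-A⁻¹) *ᵥ (A *ᵥ v)).re) ∈ Hset γ ∩ Vset α ∩ Kset δ ↔
      ∀ i, lmiForms γ δ α A v i ≤ 0 := by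
  have hinv : (-A⁻¹) *ᵥ (A *ᵥ v) = -v := by
    rw [neg_mulVec, mulVec_mulVec, nonsing_inv_mul A hA, one_mulVec]
  have hconj : star (A *ᵥ v) ⬝ᵥ v = star (star v ⬝ᵥ A *ᵥ v) := by
    rw [← star_dotProduct_star, star_star]
  have hAA : star v ⬝ᵥ (Aᴴ * A) *ᵥ v = 1 := by
    rw [← hv, star_mulVec, ← mulVec_mulVec, dotProduct_mulVec]
  have hz : 0 ≤ (star v ⬝ᵥ v).re := (Complex.le_def.1 (dotProduct_star_self_nonneg v)).1
  have hcs : (star v ⬝ᵥ A *ᵥ v).re ^ 2 + (star v ⬝ᵥ A *ᵥ v).im ^ 2 ≤ (star v ⬝ᵥ v).re := by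
    have key := star_dotProduct_mulVec_smul_add_smul (1 : Matrix (Fin n) (Fin n) ℂ) v (A *ᵥ v) 1
      (-star (star v ⬝ᵥ A *ᵥ v))
    have hnn := dotProduct_star_self_nonneg
      ((1 : ℂ) • v + (-star (star v ⬝ᵥ A *ᵥ v)) • (A *ᵥ v))
    rw [one_mulVec, one_mulVec, one_mulVec, hv, hconj] at key
    rw [key] at hnn
    have hre := (Complex.le_def.1 hnn).1
    simp at hre
    linarith
  have habs : |(star v ⬝ᵥ A *ᵥ v).im| * Real.cos α = |(star v ⬝ᵥ A *ᵥ v).im * Real.cos α| := by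
    rw [abs_mul, abs_of_nonneg hα]
  simp only [hinv, dotProduct_neg, neg_dotProduct, star_neg, neg_neg, hconj, Complex.star_def,
    Complex.neg_re, Complex.neg_im, Complex.conj_re, Complex.conj_im, Hset, Vset, Kset,
    Set.mem_inter_iff, Set.mem_ofPred_eq, neg_sq, habs, abs_le, hcs, true_and]
  constructor
  · rintro ⟨⟨hH, -, hV₁, hV₂⟩, hK⟩ i
    fin_cases i <;> simp [lmiForms, hAA] <;> linarith
  · intro h
    have h₀ := h 0
    have h₁ := h 1
    have h₂ := h 2
    have h₃ := h 3
    simp [lmiForms, hAA] at h₀ h₁ h₂ h₃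
    refine ⟨⟨h₀, ?_, ?_, ?_⟩, ?_⟩ <;> nlinarith

/-- DW-shell separation from `H_γ ∩ V_α ∩ K_δ` is equivalent to feasibility of an LMI. -/
theorem dw_separation_iff_lmi {n : ℕ} (hn : 3 ≤ n) (γ δ α : ℝ) (hγ : 0 < γ)
    (hδ : γ ≤ δ) (hα : α ∈ Set.Ico (0 : ℝ) (Real.pi / 2))
    (A : Matrix (Fin n) (Fin n) ℂ) (hA : IsUnit A.det) :
    DW (-A⁻¹) ∩ (Hset γ ∩ Vset α ∩ Kset δ) = ∅ ↔
      ∃ k₁ k₂ k₃ k₄ : ℝ, 0 ≤ k₁ ∧ 0 ≤ k₂ ∧ 0 ≤ k₃ ∧ 0 ≤ k₄ ∧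
        (k₁ • ((1 : Matrix (Fin n) (Fin n) ℂ) - ((γ ^ 2 : ℝ) : ℂ) • (Aᴴ * A))
          + k₂ • Hpart (Complex.exp (-Complex.I * ((Real.pi / 2 - α : ℝ) : ℂ)) • A)
          + k₃ • Hpart (Complex.exp (Complex.I * ((Real.pi / 2 - α : ℝ) : ℂ)) • A)
          + k₄ • (((δ : ℂ) • Hpart A) + 1)).PosDef := by
  have : NeZero n := ⟨by omega⟩
  have hδ0 : 0 < δ := hγ.trans_le hδ
  have hcos : 0 ≤ Real.cos α :=
    Real.cos_nonneg_of_mem_Icc ⟨by linarith [hα.1, Real.pi_pos], hα.2.le⟩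
  constructor
  · intro hempty
    obtain ⟨k, hk, hpos⟩ := exists_nonneg_multipliers (lmiForms γ δ α A)
      (continuous_lmiForms γ δ α A) (lmiForms_smul γ δ α A) (exists_lmiForms_le_add γ δ α A) (by
        intro v hv
        by_contra! hle
        have hAv : A *ᵥ v ≠ 0 := fun h => hv <| by
          rw [← one_mulVec v, ← nonsing_inv_mul A hA, ← mulVec_mulVec, h, mulVec_zero]
        obtain ⟨r, -, hr⟩ := exists_smul_star_dotProduct_self_eq_one hAv
        rw [← mulVec_smul] at hr
        refine Set.eq_empty_iff_forall_notMem.1 hempty _ ⟨⟨_, hr, rfl⟩,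
          (mem_inter_iff_lmiForms_nonpos hδ0 hcos A hA hr).2 fun i => ?_⟩
        rw [lmiForms_smul]
        exact mul_nonpos_of_nonneg_of_nonpos (sq_nonneg r) (hle i))
    refine ⟨k 0, k 1, k 2, k 3, hk 0, hk 1, hk 2, hk 3,
      PosDef.of_dotProduct_mulVec_pos (isHermitian_lmi γ δ α A _ _ _ _) fun v hv => ?_⟩
    rw [star_dotProduct_lmi_mulVec, Complex.zero_lt_real]
    simpa only [Fin.sum_univ_four] using hpos v hv
  · rintro ⟨k₁, k₂, k₃, k₄, h₁, h₂, h₃, h₄, hpd⟩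
    refine Set.eq_empty_of_forall_notMem ?_
    rintro _ ⟨⟨u, hu, rfl⟩, hmem⟩
    obtain ⟨v, rfl⟩ : ∃ v, u = A *ᵥ v :=
      ⟨A⁻¹ *ᵥ u, by rw [mulVec_mulVec, mul_nonsing_inv A hA, one_mulVec]⟩
    have hv : v ≠ 0 := by rintro rfl; simp at hu
    have hpos := hpd.dotProduct_mulVec_pos hv
    rw [star_dotProduct_lmi_mulVec, Complex.zero_lt_real] at hpos
    have hle := (mem_inter_iff_lmiForms_nonpos hδ0 hcos A hA hu).1 hmem
    linarith [mul_nonpos_of_nonneg_of_nonpos h₁ (hle 0), mul_nonpos_of_nonneg_of_nonpos h₂ (hle 1),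
      mul_nonpos_of_nonneg_of_nonpos h₃ (hle 2), mul_nonpos_of_nonneg_of_nonpos h₄ (hle 3)]
end
end

section
/- Let n ≥ 1, γ > 0 and let α, β be real numbers with −π ≤ (α+β)/2 < π and 0 < β−α < π, and let A be an n×n complex matrix. If there exist nonnegative real numbers k₁, k₂, k₃, k₄ such that the Hermitian matrix k₁·(I − γ²·A*A) + k₂·(γ·sec²((β−α)/2)·H(e^{i(α+β)/2}·A) + I) + k₃·H(e^{−i(π/2−β)}·A) + k₄·H(e^{i(π/2+α)}·A) is positive definite, then det(I + A·B) ≠ 0 for every matrix B ∈ S_γ(α,β). -/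
open Matrix
open scoped ComplexOrder

noncomputable section

/-- Membership in the sectored-disk set `S_γ(α,β)`. -/
def memSDab {n : ℕ} (γ α β : ℝ) (B : Matrix (Fin n) (Fin n) ℂ) : Prop :=
  (((γ ^ 2 : ℝ) : ℂ) • (1 : Matrix (Fin n) (Fin n) ℂ) - Bᴴ * B).PosSemidef ∧
  (Hpart (Complex.exp (Complex.I * ((Real.pi / 2 - β : ℝ) : ℂ)) • B)).PosSemidef ∧
  (Hpart (Complex.exp (-Complex.I * ((Real.pi / 2 + α : ℝ) : ℂ)) • B)).PosSemidef

open ComplexConjugate in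
/-- The sesquilinear form of `H(zB)` is the Hermitian part of that of `zB`. -/
lemma star_dotProduct_Hpart_smul_mulVec {n : ℕ} (z : ℂ) (B : Matrix (Fin n) (Fin n) ℂ)
    (u v : Fin n → ℂ) :
    star u ⬝ᵥ (Hpart (z • B) *ᵥ v) =
      (z * (star u ⬝ᵥ (B *ᵥ v)) + conj z * conj (star v ⬝ᵥ (B *ᵥ u))) / 2 := by
  have e : star u ⬝ᵥ (Bᴴ *ᵥ v) = conj (star v ⬝ᵥ (B *ᵥ u)) := by
    rw [starRingEnd_apply, star_dotProduct, star_mulVec, conjTranspose_conjTranspose,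
      dotProduct_mulVec]
  rw [Hpart, smul_mulVec, add_mulVec, conjTranspose_smul, smul_mulVec, smul_mulVec,
    dotProduct_smul, dotProduct_add, dotProduct_smul, dotProduct_smul, e]
  simp only [smul_eq_mul, starRingEnd_apply]
  ring

lemma re_star_dotProduct_Hpart_smul_mulVec {n : ℕ} (z : ℂ) (B : Matrix (Fin n) (Fin n) ℂ)
    (u : Fin n → ℂ) :
    (star u ⬝ᵥ (Hpart (z • B) *ᵥ u)).re = (z * (star u ⬝ᵥ (B *ᵥ u))).re := by
  rw [star_dotProduct_Hpart_smul_mulVec, ← map_mul, Complex.add_conj]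
  simp

/-- Cauchy–Schwarz for the form of a positive semidefinite matrix. -/
lemma Matrix.PosSemidef.norm_dotProduct_mulVec_sq_le {ι : Type*} [Fintype ι]
    {P : Matrix ι ι ℂ} (hP : P.PosSemidef) (u v : ι → ℂ) :
    ‖star u ⬝ᵥ (P *ᵥ v)‖ ^ 2 ≤
      (star u ⬝ᵥ (P *ᵥ u)).re * (star v ⬝ᵥ (P *ᵥ v)).re := by
  let := P.toSeminormedAddCommGroup hP
  let := P.toInnerProductSpace hP
  have key := inner_mul_inner_self_le (𝕜 := ℂ) u v
  rw [norm_inner_symm v u, ← sq] at key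
  have e (a b : ι → ℂ) : inner ℂ a b = star a ⬝ᵥ (P *ᵥ b) := dotProduct_comm _ _
  simp only [e] at key
  exact key

lemma add_sq_le_add_mul_add {p q a b c d : ℝ} (ha : 0 ≤ a) (hb : 0 ≤ b) (hc : 0 ≤ c)
    (hd : 0 ≤ d) (hp : p ^ 2 ≤ a * b) (hq : q ^ 2 ≤ c * d) :
    (p + q) ^ 2 ≤ (a + c) * (b + d) := by
  have hpq : p * q ≤ (a * d + c * b) / 2 := by
    apply le_of_sq_le_sq _ (by positivity)
    calc (p * q) ^ 2 = p ^ 2 * q ^ 2 := by ring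
      _ ≤ (a * b) * (c * d) := by gcongr
      _ ≤ ((a * d + c * b) / 2) ^ 2 := by nlinarith [sq_nonneg (a * d - c * b)]
  nlinarith

lemma re_star_dotProduct_self_nonneg {ι : Type*} [Fintype ι] (v : ι → ℂ) :
    0 ≤ (star v ⬝ᵥ v).re :=
  (Complex.nonneg_iff.1 (dotProduct_star_self_nonneg v)).1

/-- `γ² I - B*B ≥ 0` bounds `‖Bv‖` by `γ‖v‖`. -/
lemma Matrix.PosSemidef.re_star_mulVec_dotProduct_le {ι : Type*} [Fintype ι] [DecidableEq ι]
    {r : ℝ} {B : Matrix ι ι ℂ} (hB : ((r : ℂ) • (1 : Matrix ι ι ℂ) - Bᴴ * B).PosSemidef)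
    (v : ι → ℂ) : (star (B *ᵥ v) ⬝ᵥ (B *ᵥ v)).re ≤ r * (star v ⬝ᵥ v).re := by
  have h := (Complex.nonneg_iff.1 (hB.dotProduct_mulVec_nonneg v)).1
  rw [sub_mulVec, dotProduct_sub, smul_mulVec, one_mulVec, dotProduct_smul, ← mulVec_mulVec,
    dotProduct_mulVec (star v), ← star_mulVec, smul_eq_mul, Complex.sub_re,
    Complex.re_ofReal_mul] at h
  linarith

lemma Complex.conj_exp_I_mul_ofReal (x : ℝ) :
    starRingEnd ℂ (Complex.exp (Complex.I * x)) = Complex.exp (-Complex.I * x) := by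
  rw [← Complex.exp_conj, map_mul, Complex.conj_I, Complex.conj_ofReal]

/-- A matrix in the sectored disk satisfies
`‖Bx‖² ≤ γ sec²((β - α) / 2) Re (e^{-i(α+β)/2} x*Bx)`. -/
lemma memSDab.cos_sq_mul_le {n : ℕ} {γ α β : ℝ} (hγ : 0 < γ) (hαβ : 0 < β - α)
    (hαβ' : β - α < Real.pi) {B : Matrix (Fin n) (Fin n) ℂ} (hB : memSDab γ α β B)
    (x : Fin n → ℂ) :
    Real.cos ((β - α) / 2) ^ 2 * (star (B *ᵥ x) ⬝ᵥ (B *ᵥ x)).re ≤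
      γ * (Complex.exp (-Complex.I * (((α + β) / 2 : ℝ) : ℂ)) * (star x ⬝ᵥ (B *ᵥ x))).re := by
  obtain ⟨hD, hP, hQ⟩ := hB
  set θ := (β - α) / 2 with hθ
  set φ := (α + β) / 2 with hφ
  have hs : 0 < Real.sin θ := Real.sin_pos_of_pos_of_lt_pi (by linarith) (by linarith)
  set a := Complex.exp (Complex.I * (φ : ℂ)) with ha
  set a' := Complex.exp (-Complex.I * (φ : ℂ)) with ha'
  set t := Complex.exp (Complex.I * (θ : ℂ)) with ht
  set t' := Complex.exp (-Complex.I * (θ : ℂ)) with ht'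
  have haa : a * a' = 1 := by rw [ha, ha', ← Complex.exp_add]; simp
  have hconj_a : starRingEnd ℂ a' = a := by
    rw [ha', ← Complex.conj_exp_I_mul_ofReal, Complex.conj_conj]
  have hconj_t : starRingEnd ℂ t = t' := Complex.conj_exp_I_mul_ofReal θ
  have hconj_t' : starRingEnd ℂ t' = t := by rw [← hconj_t, Complex.conj_conj]
  have norm_a : ‖a‖ = 1 := by rw [ha, mul_comm]; exact Complex.norm_exp_ofReal_mul_I φ
  have norm_a' : ‖a'‖ = 1 := by rw [← norm_a, ← hconj_a, Complex.norm_conj]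
  have norm_t : ‖t‖ = 1 := by rw [ht, mul_comm]; exact Complex.norm_exp_ofReal_mul_I θ
  have norm_t' : ‖t'‖ = 1 := by rw [← norm_t, ← hconj_t, Complex.norm_conj]
  have ht_eq : t = Real.cos θ + Real.sin θ * Complex.I := by
    rw [ht, mul_comm, Complex.exp_mul_I, Complex.ofReal_cos, Complex.ofReal_sin]
  have ht'_eq : t' = Real.cos θ - Real.sin θ * Complex.I := by
    rw [← hconj_t, ht_eq]
    simp only [map_add, map_mul, Complex.conj_I, Complex.conj_ofReal]
    ring
  have exp_pi : Complex.exp (Complex.I * ((Real.pi / 2 : ℝ) : ℂ)) = Complex.I := by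
    rw [mul_comm, Complex.ofReal_div, Complex.ofReal_ofNat, Complex.exp_pi_div_two_mul_I]
  have exp_neg_pi : Complex.exp (-Complex.I * ((Real.pi / 2 : ℝ) : ℂ)) = -Complex.I := by
    rw [← Complex.conj_exp_I_mul_ofReal, exp_pi, Complex.conj_I]
  have hw₁ : Complex.exp (Complex.I * ((Real.pi / 2 - β : ℝ) : ℂ)) = Complex.I * a' * t' := by
    conv_rhs => rw [← exp_pi, ha', ht', ← Complex.exp_add, ← Complex.exp_add, hφ, hθ]
    congr 1
    push_cast
    ring
  have hw₂ : Complex.exp (-Complex.I * ((Real.pi / 2 + α : ℝ) : ℂ)) = -Complex.I * a' * t := by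
    conv_rhs => rw [← exp_neg_pi, ha', ht, ← Complex.exp_add, ← Complex.exp_add, hφ, hθ]
    congr 1
    push_cast
    ring
  rw [hw₁] at hP
  rw [hw₂] at hQ
  have sum_forms (u : Fin n → ℂ) :
      (star u ⬝ᵥ (Hpart ((Complex.I * a' * t') • B) *ᵥ u)).re +
        (star u ⬝ᵥ (Hpart ((-Complex.I * a' * t) • B) *ᵥ u)).re =
      2 * Real.sin θ * (a' * (star u ⬝ᵥ (B *ᵥ u))).re := by
    rw [re_star_dotProduct_Hpart_smul_mulVec, re_star_dotProduct_Hpart_smul_mulVec,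
      ← Complex.add_re, ← Complex.re_ofReal_mul, ht_eq, ht'_eq]
    congr 1
    push_cast
    linear_combination (-2 * Complex.sin θ * a' * (star u ⬝ᵥ (B *ᵥ u))) * Complex.I_sq
  have hP_nonneg (u : Fin n → ℂ) := (Complex.nonneg_iff.1 (hP.dotProduct_mulVec_nonneg u)).1
  have hQ_nonneg (u : Fin n → ℂ) := (Complex.nonneg_iff.1 (hQ.dotProduct_mulVec_nonneg u)).1
  set y := B *ᵥ x with hy
  have cauchy := add_sq_le_add_mul_add (hP_nonneg y) (hP_nonneg x) (hQ_nonneg y) (hQ_nonneg x)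
    (hP.norm_dotProduct_mulVec_sq_le y x) (hQ.norm_dotProduct_mulVec_sq_le y x)
  rw [sum_forms, sum_forms] at cauchy
  have decomp : ((2 * Real.sin θ * Real.cos θ : ℝ) : ℂ) * (star y ⬝ᵥ y) =
      a * (t' * (star y ⬝ᵥ (Hpart ((Complex.I * a' * t') • B) *ᵥ x)) +
        t * (star y ⬝ᵥ (Hpart ((-Complex.I * a' * t) • B) *ᵥ x))) := by
    rw [star_dotProduct_Hpart_smul_mulVec, star_dotProduct_Hpart_smul_mulVec, ← hy]
    simp only [map_mul, map_neg, hconj_a, hconj_t, hconj_t', Complex.conj_I]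
    generalize star y ⬝ᵥ y = b
    generalize starRingEnd ℂ (star x ⬝ᵥ (B *ᵥ y)) = b'
    rw [ht_eq, ht'_eq]
    push_cast
    linear_combination (2 * Complex.sin θ * Complex.cos θ * b * Complex.I ^ 2) * haa
      + (2 * Complex.sin θ * Complex.cos θ * b) * Complex.I_sq
  set N := (star y ⬝ᵥ y).re with hN
  have hN_nonneg : 0 ≤ N := re_star_dotProduct_self_nonneg y
  have lower : 2 * Real.sin θ * Real.cos θ * N ≤
      ‖star y ⬝ᵥ (Hpart ((Complex.I * a' * t') • B) *ᵥ x)‖ +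
        ‖star y ⬝ᵥ (Hpart ((-Complex.I * a' * t) • B) *ᵥ x)‖ := by
    rw [hN, ← Complex.re_ofReal_mul, decomp]
    refine (Complex.re_le_norm _).trans ?_
    rw [norm_mul, norm_a, one_mul]
    refine (norm_add_le _ _).trans_eq ?_
    rw [norm_mul, norm_mul, norm_t, norm_t', one_mul, one_mul]
  have hc : 0 ≤ Real.cos θ :=
    Real.cos_nonneg_of_neg_pi_div_two_le_of_le (by linarith [Real.pi_pos]) (by linarith)
  have upper : (a' * (star y ⬝ᵥ (B *ᵥ y))).re ≤ γ * N := by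
    refine (Complex.re_le_norm _).trans ?_
    rw [norm_mul, norm_a', one_mul]
    apply le_of_sq_le_sq _ (by positivity)
    have h := Matrix.PosSemidef.one.norm_dotProduct_mulVec_sq_le y (B *ᵥ y)
    rw [one_mulVec, one_mulVec] at h
    nlinarith [mul_le_mul_of_nonneg_left (hD.re_star_mulVec_dotProduct_le y) hN_nonneg]
  have hx_nonneg : 0 ≤ (a' * (star x ⬝ᵥ y)).re := by
    have h := add_nonneg (hP_nonneg x) (hQ_nonneg x)
    rw [sum_forms] at h
    exact nonneg_of_mul_nonneg_right h (by positivity)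
  set R := (a' * (star x ⬝ᵥ y)).re
  rcases hN_nonneg.eq_or_lt with h0 | hpos
  · rw [← h0, mul_zero]
    positivity
  have squared := (pow_le_pow_left₀ (by positivity) lower 2).trans cauchy
  have bound : (2 * Real.sin θ) ^ 2 * N * (Real.cos θ ^ 2 * N) ≤
      (2 * Real.sin θ) ^ 2 * N * (γ * R) := by
    have := mul_le_mul_of_nonneg_left upper
      (show 0 ≤ (2 * Real.sin θ) ^ 2 * R by positivity)
    linarith
  exact le_of_mul_le_mul_left bound (by positivity)

/-- Sufficient condition for the asymmetric matrix sectored-disk problem. -/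
theorem sectored_disk_sufficient_asymmetric {n : ℕ} (hn : 1 ≤ n) (γ α β : ℝ) (hγ : 0 < γ)
    (hαβ₁ : -Real.pi ≤ (α + β) / 2) (hαβ₂ : (α + β) / 2 < Real.pi)
    (hαβ₃ : 0 < β - α) (hαβ₄ : β - α < Real.pi)
    (A : Matrix (Fin n) (Fin n) ℂ)
    (h : ∃ k₁ k₂ k₃ k₄ : ℝ, 0 ≤ k₁ ∧ 0 ≤ k₂ ∧ 0 ≤ k₃ ∧ 0 ≤ k₄ ∧
      (k₁ • ((1 : Matrix (Fin n) (Fin n) ℂ) - ((γ ^ 2 : ℝ) : ℂ) • (Aᴴ * A))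
        + k₂ • ((((γ / Real.cos ((β - α) / 2) ^ 2 : ℝ) : ℂ) •
            Hpart (Complex.exp (Complex.I * (((α + β) / 2 : ℝ) : ℂ)) • A)) + 1)
        + k₃ • Hpart (Complex.exp (-Complex.I * ((Real.pi / 2 - β : ℝ) : ℂ)) • A)
        + k₄ • Hpart (Complex.exp (Complex.I * ((Real.pi / 2 + α : ℝ) : ℂ)) • A)).PosDef) :
    ∀ B : Matrix (Fin n) (Fin n) ℂ, memSDab γ α β B → (1 + A * B).det ≠ 0 := by
  obtain ⟨k₁, k₂, k₃, k₄, hk₁, hk₂, hk₃, hk₄, hM⟩ := h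
  intro B hB hdet
  obtain ⟨x, hx, hABx⟩ := exists_mulVec_eq_zero_iff.2 hdet
  set y := B *ᵥ x with hy
  have hAy : A *ᵥ y = -x := by
    rw [add_mulVec, one_mulVec, ← mulVec_mulVec] at hABx
    exact (neg_eq_of_add_eq_zero_right hABx).symm
  have hy_ne : y ≠ 0 := by
    rintro h0
    rw [h0, mulVec_zero] at hAy
    exact hx (neg_eq_zero.1 hAy.symm)
  have hform (z : ℂ) : (star y ⬝ᵥ (Hpart (z • A) *ᵥ y)).re =
      -(starRingEnd ℂ z * (star x ⬝ᵥ y)).re := by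
    rw [re_star_dotProduct_Hpart_smul_mulVec, hAy, dotProduct_neg, mul_neg, Complex.neg_re,
      ← Complex.conj_re, map_mul, starRingEnd_apply (star y ⬝ᵥ x), star_dotProduct, star_star]
  have hpos := (Complex.pos_iff.1 (hM.dotProduct_mulVec_pos hy_ne)).1
  have hconj (r : ℝ) : starRingEnd ℂ (Complex.exp (-Complex.I * r)) =
      Complex.exp (Complex.I * r) := by
    rw [← Complex.conj_exp_I_mul_ofReal, Complex.conj_conj]
  simp only [add_mulVec, sub_mulVec, smul_mulVec, one_mulVec, dotProduct_add, dotProduct_sub,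
    dotProduct_smul, Complex.add_re, Complex.sub_re, Complex.smul_re, smul_eq_mul,
    Complex.re_ofReal_mul, hform, hconj, Complex.conj_exp_I_mul_ofReal, ← mulVec_mulVec] at hpos
  rw [dotProduct_mulVec (star y) Aᴴ, ← star_mulVec, hAy, star_neg, neg_dotProduct_neg] at hpos
  have hsector := hB.cos_sq_mul_le hγ hαβ₃ hαβ₄ x
  obtain ⟨hD, hP, hQ⟩ := hB
  have hnorm := hD.re_star_mulVec_dotProduct_le x
  have hP_nonneg := (Complex.nonneg_iff.1 (hP.dotProduct_mulVec_nonneg x)).1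
  have hQ_nonneg := (Complex.nonneg_iff.1 (hQ.dotProduct_mulVec_nonneg x)).1
  rw [re_star_dotProduct_Hpart_smul_mulVec, ← hy] at hP_nonneg hQ_nonneg
  rw [← hy] at hnorm hsector
  have hc : 0 < Real.cos ((β - α) / 2) :=
    Real.cos_pos_of_mem_Ioo ⟨by linarith [Real.pi_pos], by linarith⟩
  have hsector' : (star y ⬝ᵥ y).re ≤ γ / Real.cos ((β - α) / 2) ^ 2 *
      (Complex.exp (-Complex.I * (((α + β) / 2 : ℝ) : ℂ)) * (star x ⬝ᵥ y)).re := by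
    rw [div_mul_eq_mul_div, le_div_iff₀ (by positivity)]
    linarith
  have h₁ := mul_nonneg hk₁ (sub_nonneg.2 hnorm)
  have h₂ := mul_nonneg hk₂ (sub_nonneg.2 hsector')
  have h₃ := mul_nonneg hk₃ hP_nonneg
  have h₄ := mul_nonneg hk₄ hQ_nonneg
  linarith
end
end
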